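/- Let F_V be a CDF in the domain of attraction of G_ξ with constants (a_K, b_K), let ξ < 1, and suppose E[|V|^{1+ε}] < ∞ for some ε > 0. For each x ∈ ℝ, ∫_{-∞}^x (F_V(h a_K + b_K)^K - G_ξ(h)) dh → 0 as K → ∞. -/

import Mathlib

open MeasureTheory Filter Set

/-- The generalized extreme value CDF with tail index `ξ`. -/
noncomputable def GEV (ξ x : ℝ) : ℝ :=
  if ξ = 0 then Real.exp (-Real.exp (-x))
  else if 0 < 1 + ξ * x then Real.exp (-(1 + ξ * x) ^ (-1 / ξ))
  else if 0 < ξ then 0 else 1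

lemma GEV_pos_lt (ξ y : ℝ) (h : 0 < 1 + ξ * y) : 0 < GEV ξ y ∧ GEV ξ y < 1 := by
  unfold GEV
  split_ifs with h0
  · exact ⟨Real.exp_pos _, by rw [Real.exp_lt_one_iff]; have := Real.exp_pos (-y); linarith⟩
  · exact ⟨Real.exp_pos _, by
      rw [Real.exp_lt_one_iff]; have := Real.rpow_pos_of_pos h (-1 / ξ); linarith⟩

lemma GEV_nonneg (ξ y : ℝ) : 0 ≤ GEV ξ y := by
  unfold GEV
  split_ifs <;> positivity

lemma GEV_cont (ξ y : ℝ) (h : 1 + ξ * y ≠ 0) : ContinuousAt (GEV ξ) y := by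
  by_cases h0 : ξ = 0
  · have : GEV ξ = fun x => Real.exp (-Real.exp (-x)) := by
      funext x; simp [GEV, h0]
    rw [this]; fun_prop
  · have hc : Continuous (fun x : ℝ => 1 + ξ * x) := by fun_prop
    rcases lt_or_gt_of_ne h with h | h
    · have : GEV ξ =ᶠ[nhds y] fun _ => (if 0 < ξ then 0 else 1 : ℝ) := by
        filter_upwards [hc.continuousAt.eventually_lt continuousAt_const h] with x hx
        simp [GEV, h0, not_lt.2 hx.le]
      exact continuousAt_const.congr this.symm
    · have : GEV ξ =ᶠ[nhds y] fun x => Real.exp (-(1 + ξ * x) ^ (-1 / ξ)) := by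
        filter_upwards [continuousAt_const.eventually_lt hc.continuousAt h] with x hx
        simp [GEV, h0, hx]
      refine ContinuousAt.congr ?_ this.symm
      have h2 : ContinuousAt (fun x : ℝ => (1 + ξ * x) ^ (-1 / ξ)) y :=
        hc.continuousAt.rpow_const (Or.inl h.ne')
      exact Real.continuous_exp.continuousAt.comp h2.neg

lemma GEV_atBot (ξ : ℝ) : Tendsto (GEV ξ) atBot (nhds 0) := by
  rcases lt_trichotomy ξ 0 with h | h | h
  · have h1 : Tendsto (fun x : ℝ => 1 + ξ * x) atBot atTop :=
      tendsto_atTop_add_const_left _ _ (tendsto_id.const_mul_atBot_of_neg h)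
    have hp : 0 < -1 / ξ := div_pos_of_neg_of_neg (by norm_num) h
    have h2 := Real.tendsto_exp_neg_atTop_nhds_zero.comp ((tendsto_rpow_atTop hp).comp h1)
    refine h2.congr' ?_
    filter_upwards [h1.eventually_gt_atTop 0] with x hx
    simp [GEV, h.ne, hx]
  · have h2 := Real.tendsto_exp_neg_atTop_nhds_zero.comp
      (Real.tendsto_exp_atTop.comp tendsto_neg_atBot_atTop)
    refine h2.congr' ?_
    filter_upwards with x
    simp [GEV, h]
  · have h1 : Tendsto (fun x : ℝ => 1 + ξ * x) atBot atBot :=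
      tendsto_atBot_add_const_left _ _ (tendsto_id.const_mul_atBot h)
    refine tendsto_const_nhds.congr' ?_
    filter_upwards [h1.eventually_le_atBot 0] with x hx
    simp [GEV, h.ne', not_lt.2 hx, h]

lemma GEV_meas (ξ : ℝ) : Measurable (GEV ξ) := by
  unfold GEV
  refine Measurable.ite (by simp) (by fun_prop) ?_
  refine Measurable.ite (measurableSet_lt measurable_const (by fun_prop)) (by fun_prop) (by fun_prop)

lemma GEV_evne (ξ : ℝ) : ∀ᶠ y in atBot, 1 + ξ * y ≠ 0 := by
  filter_upwards [eventually_lt_atBot (-1/ξ)] with y hy h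
  by_cases h0 : ξ = 0
  · simp [h0] at h
  · apply hy.ne
    field_simp
    linarith

/-- One halving step. -/
lemma halving (F : ℝ → ℝ) (hm : Monotone F) (h0 : ∀ u, 0 ≤ F u) (h1 : ∀ u, F u ≤ 1) (ξ : ℝ)
    (a b : ℕ → ℝ) (ha : ∀ K, 0 < a K)
    (hconv : ∀ x : ℝ, ContinuousAt (GEV ξ) x →
      Tendsto (fun K : ℕ => F (a K * x + b K) ^ K) atTop (nhds (GEV ξ x))) :
    ∃ D : ℝ, 1 ≤ D ∧ ∀ᶠ K in atTop, a (K / 2) ≤ D * a K ∧ b K - b (K / 2) ≤ D * a K := by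
  have hdiv : Tendsto (fun K : ℕ => K / 2) atTop atTop := Nat.tendsto_div_const_atTop (by norm_num)
  have g0 : 0 < GEV ξ 0 := (GEV_pos_lt ξ 0 (by simp)).1
  obtain ⟨p, hp1, hp2, hp3⟩ := (((GEV_atBot ξ).eventually_lt_const (pow_pos g0 3)).and
    ((GEV_evne ξ).and (eventually_lt_atBot 0))).exists
  obtain ⟨q, hq, hq2⟩ : ∃ q : ℝ, 0 < q ∧ 0 < 1 + ξ * q := by
    refine ⟨1 / (2 * |ξ| + 1), by positivity, ?_⟩
    have : 1 + ξ * (1 / (2 * |ξ| + 1)) = (2 * |ξ| + 1 + ξ) / (2 * |ξ| + 1) := by field_simp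
    rw [this]
    have := neg_abs_le ξ
    have := abs_nonneg ξ
    apply div_pos <;> linarith
  obtain ⟨gq0, gq1⟩ := GEV_pos_lt ξ q hq2
  have t0 := ((hconv 0 (GEV_cont ξ 0 (by simp))).comp hdiv).pow 3
  have tp := hconv p (GEV_cont ξ p hp2)
  have tq := hconv q (GEV_cont ξ q hq2.ne')
  have tq2 := (tq.comp hdiv).pow 2
  have e1 := tp.eventually_lt t0 hp1
  have e2 := tq2.eventually_lt tq (by nlinarith)
  refine ⟨max 1 (max (-p) ((q - p) / q)), le_max_left _ _, ?_⟩
  filter_upwards [e1, e2, eventually_ge_atTop 2] with K e1 e2 hK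
  have c1 : a K * p + b K < b (K / 2) := by
    by_contra! hc
    have hF := pow_le_pow_left₀ (h0 _) (hm hc) K
    have : (F (a (K / 2) * 0 + b (K / 2)) ^ (K / 2)) ^ 3 ≤ F (b (K / 2)) ^ K := by
      rw [← pow_mul, mul_zero, zero_add]
      exact pow_le_pow_of_le_one (h0 _) (h1 _) (by omega)
    simp only [Function.comp] at e1
    linarith
  have c2 : a (K / 2) * q + b (K / 2) < a K * q + b K := by
    by_contra! hc
    have hF := pow_le_pow_left₀ (h0 _) (hm hc) K
    have : F (a (K / 2) * q + b (K / 2)) ^ K ≤ (F (a (K / 2) * q + b (K / 2)) ^ (K / 2)) ^ 2 := by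
      rw [← pow_mul]
      exact pow_le_pow_of_le_one (h0 _) (h1 _) (by omega)
    simp only [Function.comp] at e2
    linarith
  have haK := ha K
  constructor
  · have : a (K / 2) ≤ (q - p) / q * a K := by
      rw [div_mul_eq_mul_div, le_div_iff₀ hq]; nlinarith
    refine this.trans (mul_le_mul_of_nonneg_right ?_ haK.le)
    exact (le_max_right _ _).trans (le_max_right _ _)
  · have : b K - b (K / 2) ≤ (-p) * a K := by nlinarith
    refine this.trans (mul_le_mul_of_nonneg_right ?_ haK.le)
    exact (le_max_left _ _).trans (le_max_right _ _)

/-- Base bound for a single `K`. -/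
lemma base_bound (F : ℝ → ℝ) (h0 : ∀ u, 0 ≤ F u) (h1 : ∀ u, F u ≤ 1) (M : ℝ)
    (hM : ∀ u, u ≤ 0 → -u * F u ≤ M) (a b : ℝ) (ha : 0 < a) (K : ℕ) (hK : 2 ≤ K) :
    ∃ C, ∀ h ≤ 0, h ^ 2 * F (a * h + b) ^ K ≤ C := by
  refine ⟨((|M| + |b|) / a) ^ 2, fun h hh => ?_⟩
  have : F (a * h + b) ^ K ≤ F (a * h + b) ^ 2 := pow_le_pow_of_le_one (h0 _) (h1 _) hK
  have h3 : -h * F (a * h + b) ≤ (|M| + |b|) / a := by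
    rw [le_div_iff₀ ha]
    have f0 := h0 (a * h + b)
    have f1 := h1 (a * h + b)
    have hb : b * F (a * h + b) ≤ |b| := by
      calc b * F (a * h + b) ≤ |b| * F (a * h + b) :=
            mul_le_mul_of_nonneg_right (le_abs_self b) f0
        _ ≤ |b| * 1 := mul_le_mul_of_nonneg_left f1 (abs_nonneg b)
        _ = |b| := mul_one _
    have hu : -(a * h + b) * F (a * h + b) ≤ |M| := by
      rcases le_total (a * h + b) 0 with hu | hu
      · exact (hM _ hu).trans (le_abs_self M)
      · have := mul_nonneg hu f0
        have := abs_nonneg M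
        linarith
    nlinarith
  calc h ^ 2 * F (a * h + b) ^ K ≤ h ^ 2 * F (a * h + b) ^ 2 :=
        mul_le_mul_of_nonneg_left this (sq_nonneg h)
    _ = (-h * F (a * h + b)) ^ 2 := by ring
    _ ≤ _ := pow_le_pow_left₀ (mul_nonneg (by linarith) (h0 _)) h3 2

/-- Uniform quadratic tail bound. -/
lemma tail_bound (F : ℝ → ℝ) (hm : Monotone F) (h0 : ∀ u, 0 ≤ F u) (h1 : ∀ u, F u ≤ 1) (ξ : ℝ)
    (M : ℝ) (hM : ∀ u, u ≤ 0 → -u * F u ≤ M)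
    (a b : ℕ → ℝ) (ha : ∀ K, 0 < a K)
    (hconv : ∀ x : ℝ, ContinuousAt (GEV ξ) x →
      Tendsto (fun K : ℕ => F (a K * x + b K) ^ K) atTop (nhds (GEV ξ x))) :
    ∃ C L : ℝ, 0 < L ∧ ∀ᶠ K in atTop, ∀ h ≤ -L, F (a K * h + b K) ^ K ≤ C / h ^ 2 := by
  obtain ⟨D, hD, hev⟩ := halving F hm h0 h1 ξ a b ha hconv
  have hη : 0 < 1 / (16 * D ^ 4) := by positivity
  obtain ⟨p, hp1, hp2, hp3⟩ := (((GEV_atBot ξ).eventually_lt_const hη).and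
    ((GEV_evne ξ).and (eventually_lt_atBot 0))).exists
  have tp := (hconv p (GEV_cont ξ p hp2)).eventually_lt_const hp1
  obtain ⟨m, hm0⟩ := eventually_atTop.1 (hev.and (tp.and (eventually_ge_atTop 2)))
  have hbase : ∀ K, ∃ C, 2 ≤ K → ∀ h ≤ 0, h ^ 2 * F (a K * h + b K) ^ K ≤ C := by
    intro K
    by_cases hK : 2 ≤ K
    · obtain ⟨C, hC⟩ := base_bound F h0 h1 M hM (a K) (b K) (ha K) K hK
      exact ⟨C, fun _ => hC⟩
    · exact ⟨0, fun h => absurd h hK⟩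
  choose Cb hCb using hbase
  obtain ⟨B, hB⟩ : ∃ B, ∀ K < 2 * m, Cb K ≤ B := by
    refine ⟨∑ K ∈ Finset.range (2 * m), |Cb K|, fun K hK => ?_⟩
    exact (le_abs_self _).trans
      (Finset.single_le_sum (f := fun K => |Cb K|) (fun _ _ => abs_nonneg _)
        (Finset.mem_range.2 hK))
  obtain ⟨R, hR1, hR2, hR3⟩ : ∃ R : ℝ, 2 * D ≤ R ∧ D * (-p) + D ≤ R ∧ B * (16 * D ^ 4) ≤ R ^ 2 := by
    have e := (tendsto_pow_atTop (α := ℝ) (n := 2) (by norm_num)).eventually_ge_atTop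
      (B * (16 * D ^ 4))
    obtain ⟨R, r1, r2, r3⟩ := (e.and ((eventually_ge_atTop (2 * D)).and
      (eventually_ge_atTop (D * (-p) + D)))).exists
    exact ⟨R, r2, r3, r1⟩
  have hDp : 0 < 16 * D ^ 4 := by positivity
  have key : ∀ K, m ≤ K → ∀ h ≤ p, F (a K * h + b K) ^ K ≤ (R ^ 2 / (16 * D ^ 4)) / h ^ 2 := by
    intro K
    induction K using Nat.strong_induction_on with
    | _ K ih =>
    intro hK h hh
    obtain ⟨⟨s1, s2⟩, s3, s4⟩ := hm0 K hK
    have hh0 : h < 0 := by linarith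
    have hh2 : 0 < h ^ 2 := by nlinarith
    rw [le_div_iff₀ hh2]
    by_cases hK2 : K < 2 * m
    · have := hCb K s4 h hh0.le
      have := hB K hK2
      have : B ≤ R ^ 2 / (16 * D ^ 4) := by rw [le_div_iff₀ hDp]; exact hR3
      linarith
    · by_cases hr : -R ≤ h
      · have c1 : F (a K * h + b K) ^ K ≤ 1 / (16 * D ^ 4) := by
          refine le_trans (pow_le_pow_left₀ (h0 _) (hm ?_) K) s3.le
          have := mul_le_mul_of_nonneg_left hh (ha K).le
          linarith
        have c2 : h ^ 2 ≤ R ^ 2 := by nlinarith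
        calc _ ≤ 1 / (16 * D ^ 4) * R ^ 2 := mul_le_mul c1 c2 hh2.le hη.le
          _ = _ := by ring
      · push Not at hr
        have hq := ih (K / 2) (by omega) (by omega) ((h + D) / D)
          (by rw [div_le_iff₀ (by linarith)]; nlinarith)
        have hmono : a K * h + b K ≤ a (K / 2) * ((h + D) / D) + b (K / 2) := by
          have w1 : a K * h + b K ≤ a K * (h + D) + b (K / 2) := by linarith
          have w2 : a K * (h + D) ≤ a (K / 2) * ((h + D) / D) := by
            rw [mul_div_assoc', le_div_iff₀ (by linarith)]
            nlinarith
          linarith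
        set Q := F (a (K / 2) * ((h + D) / D) + b (K / 2)) with hQ
        have hQ0 : 0 ≤ Q := h0 _
        have d1 : F (a K * h + b K) ^ K ≤ (Q ^ (K / 2)) ^ 2 := by
          refine (pow_le_pow_left₀ (h0 _) (hm hmono) K).trans ?_
          rw [← pow_mul]
          exact pow_le_pow_of_le_one (h0 _) (h1 _) (by omega)
        have d2 : Q ^ (K / 2) ≤ R ^ 2 / (4 * D ^ 2 * h ^ 2) := by
          refine hq.trans ?_
          have e1 : h ^ 2 / 4 ≤ (h + D) ^ 2 := by nlinarith
          have e2 : 0 < (h + D) ^ 2 := by linarith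
          have e3 : R ^ 2 / (16 * D ^ 4) / ((h + D) / D) ^ 2
              = R ^ 2 / (16 * D ^ 2 * (h + D) ^ 2) := by
            have : h + D ≠ 0 := by
              intro h'; rw [h'] at e2; simp at e2
            field_simp
          rw [e3]
          apply div_le_div_of_nonneg_left (sq_nonneg R) (by positivity)
          nlinarith [sq_nonneg D]
        have d3 : (Q ^ (K / 2)) ^ 2 ≤ (R ^ 2 / (4 * D ^ 2 * h ^ 2)) ^ 2 :=
          pow_le_pow_left₀ (pow_nonneg hQ0 _) d2 2
        have hRh : R ^ 2 ≤ h ^ 2 := by nlinarith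
        calc F (a K * h + b K) ^ K * h ^ 2 ≤ (R ^ 2 / (4 * D ^ 2 * h ^ 2)) ^ 2 * h ^ 2 :=
              mul_le_mul_of_nonneg_right (d1.trans d3) hh2.le
          _ = (R ^ 2 / (16 * D ^ 4)) * (R ^ 2 / h ^ 2) := by
              field_simp; ring
          _ ≤ (R ^ 2 / (16 * D ^ 4)) * 1 := by
              refine mul_le_mul_of_nonneg_left ?_ (by positivity)
              rw [div_le_one hh2]; exact hRh
          _ = _ := mul_one _
  refine ⟨R ^ 2 / (16 * D ^ 4), -p, by linarith, ?_⟩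
  filter_upwards [eventually_ge_atTop m] with K hK h hh
  exact key K hK h (by linarith)

/-- If the CDF `F` of `μ` is in the domain of attraction of `G_ξ` with constants
`(a_K, b_K)`, `ξ < 1`, and `∫ |v|^{1+ε} dμ < ∞` for some `ε > 0`, then for every `x`,
`∫_{-∞}^x (F(a_K h + b_K)^K - G_ξ(h)) dh → 0` as `K → ∞`. -/
theorem integral_cdf_convergence (μ : Measure ℝ) [IsProbabilityMeasure μ]
    (F : ℝ → ℝ) (hF : F = fun x => (μ (Set.Iic x)).toReal)
    (ξ : ℝ) (hξ : ξ < 1) (ε : ℝ) (hε : 0 < ε)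
    (hmom : Integrable (fun v : ℝ => |v| ^ (1 + ε)) μ)
    (a b : ℕ → ℝ) (ha : ∀ K, 0 < a K)
    (hconv : ∀ x : ℝ, ContinuousAt (GEV ξ) x →
      Tendsto (fun K : ℕ => F (a K * x + b K) ^ K) atTop (nhds (GEV ξ x)))
    (x : ℝ) :
    Tendsto (fun K : ℕ => ∫ h in Set.Iic x, (F (a K * h + b K) ^ K - GEV ξ h))
      atTop (nhds 0) := by
  have hF' : ∀ u, F u = μ.real (Set.Iic u) := by intro u; rw [hF]; rfl
  have hm : Monotone F := by
    intro u v huv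
    rw [hF', hF']
    exact measureReal_mono (Set.Iic_subset_Iic.2 huv)
  have h0 : ∀ u, 0 ≤ F u := fun u => by rw [hF']; exact measureReal_nonneg
  have h1 : ∀ u, F u ≤ 1 := fun u => by rw [hF']; exact measureReal_le_one
  have hM : ∀ u, u ≤ 0 → -u * F u ≤ 1 + ∫ v, |v| ^ (1 + ε) ∂μ := by
    intro u hu
    have hmk := mul_meas_ge_le_integral_of_nonneg (μ := μ) (f := fun v : ℝ => |v| ^ (1 + ε))
      (Eventually.of_forall fun v => by positivity) hmom (|u| ^ (1 + ε))
    have hsub : F u ≤ μ.real {v : ℝ | |u| ^ (1 + ε) ≤ |v| ^ (1 + ε)} := by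
      rw [hF']
      refine measureReal_mono ?_
      intro v hv
      have hv : v ≤ u := hv
      refine Real.rpow_le_rpow (abs_nonneg _) ?_ (by linarith)
      rw [abs_of_nonpos hu, abs_of_nonpos (hv.trans hu)]
      linarith
    have hle : |u| ≤ 1 + |u| ^ (1 + ε) := by
      have hp : 0 ≤ |u| ^ (1 + ε) := by positivity
      rcases le_total |u| 1 with h | h
      · linarith
      · have := Real.rpow_le_rpow_of_exponent_le h (show (1 : ℝ) ≤ 1 + ε by linarith)
        rw [Real.rpow_one] at this
        linarith
    have hs2 := mul_le_mul_of_nonneg_left hsub (show 0 ≤ |u| ^ (1 + ε) by positivity)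
    have hs3 := mul_le_mul_of_nonneg_right hle (h0 u)
    have := h1 u
    rw [← abs_of_nonpos hu]
    have hmk' : |u| ^ (1 + ε) * μ.real {v : ℝ | |u| ^ (1 + ε) ≤ |v| ^ (1 + ε)}
      ≤ ∫ v, |v| ^ (1 + ε) ∂μ := hmk
    nlinarith
  obtain ⟨C, L, hL, htail⟩ := tail_bound F hm h0 h1 ξ _ hM a b ha hconv
  have hae : ∀ᵐ h : ℝ ∂(volume.restrict (Set.Iic x)), 1 + ξ * h ≠ 0 := by
    refine ae_restrict_of_ae ?_
    have hs : Set.Subsingleton {h : ℝ | ¬ (1 + ξ * h ≠ 0)} := by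
      intro u hu v hv
      simp only [ne_eq, not_not, mem_ofPred_eq] at hu hv
      have hξ0 : ξ ≠ 0 := by rintro rfl; simp at hu
      exact mul_left_cancel₀ hξ0 (by linarith)
    exact hs.measure_zero _
  set g : ℝ → ℝ := fun h => if h ≤ -L then C / h ^ 2 else 1 with hg
  have hbd : ∀ᶠ K in atTop, ∀ h, F (a K * h + b K) ^ K ≤ g h := by
    filter_upwards [htail] with K hK h
    simp only [hg]
    split_ifs with hh
    · exact hK h hh
    · exact pow_le_one₀ (h0 _) (h1 _)
  have hgint : IntegrableOn g (Set.Iic x) := by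
    have i1 : IntegrableOn g (Set.Iic (-L)) := by
      have : IntegrableOn (fun h : ℝ => C * h ^ (-2 : ℝ)) (Set.Ioi L) :=
        (integrableOn_Ioi_rpow_of_lt (by norm_num) hL).const_mul C
      have h3 : IntegrableOn (fun h : ℝ => C * (-h) ^ (-2 : ℝ)) (Set.Iio (-L)) := by
        have := this.comp_neg
        simpa using this
      rw [integrableOn_Iic_iff_integrableOn_Iio]
      refine h3.congr_fun ?_ measurableSet_Iio
      intro h hh
      have hh : h < -L := hh
      simp only [hg, if_pos hh.le]
      rw [Real.rpow_neg (by linarith), div_eq_mul_inv]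
      norm_num
    have i2 : IntegrableOn g (Set.Ioc (-L) x) := by
      have : IntegrableOn (fun _ : ℝ => (1 : ℝ)) (Set.Ioc (-L) x) := by
        rw [integrableOn_const_iff]; right; simp
      refine this.congr_fun ?_ measurableSet_Ioc
      intro h hh
      simp only [hg, if_neg (not_le.2 hh.1)]
    refine (i1.union i2).mono_set ?_
    intro h hh
    rcases le_or_gt h (-L) with h' | h'
    · exact Or.inl h'
    · exact Or.inr ⟨h', hh⟩
  have hGm := GEV_meas ξ
  have hlim := tendsto_integral_filter_of_dominated_convergence
    (μ := volume.restrict (Set.Iic x)) (l := atTop)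
    (F := fun (K : ℕ) h => F (a K * h + b K) ^ K - GEV ξ h) (f := fun _ => (0 : ℝ)) g
    (Eventually.of_forall fun K => by
      have := hm.measurable
      exact Measurable.aestronglyMeasurable (by fun_prop))
    (by
      filter_upwards [hbd] with K hK
      filter_upwards [hae] with h hh
      have t := hconv h (GEV_cont ξ h hh)
      have hG : GEV ξ h ≤ g h := le_of_tendsto t (hbd.mono fun K hK => hK h)
      have := GEV_nonneg ξ h
      have := pow_nonneg (h0 (a K * h + b K)) K
      have := hK h
      rw [Real.norm_eq_abs, abs_le]
      constructor <;> linarith)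
    hgint
    (by
      filter_upwards [hae] with h hh
      have t := (hconv h (GEV_cont ξ h hh)).sub_const (GEV ξ h)
      simpa using t)
  simpa using hlim
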